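/- Fix a constant C > 0, and let r, t : ℕ → ℕ satisfy r(n) ≤ 0.99·n, t(n)/√(log n) → ∞, and t(n) ≤ C·log n. Then there exist a constant β > 0 and negligible functions ν₁, ν₂ such that for all n and all integers 1 ≤ g ≤ β·t(n)²: with probability at least 1 − ν₂(n) over a uniformly random G* ∈ F_2^{n×g}, the set 𝒫(G*) is nonempty and a uniformly random P* ← 𝒫(G*) has rank r(n) (i.e., full row rank) with probability at least 1 − ν₁(n). -/

import Mathlib

open Finset Filter
open scoped Classical

/-- `ν : ℕ → ℝ` is negligible if for every `k`, `ν n ≤ n⁻ᵏ` for all sufficiently large `n`. -/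
def Negligible (ν : ℕ → ℝ) : Prop :=
  ∀ k : ℕ, ∃ N : ℕ, ∀ n ≥ N, ν n ≤ 1 / (n : ℝ) ^ k

/-- `𝒫(G*)`: the set of `r × n` matrices `P` over `F₂` whose rows all have Hamming weight
exactly `t` and which satisfy `P·G* = 0`. -/
def PsetOf (t r n g : ℕ) (G : Matrix (Fin n) (Fin g) (ZMod 2)) :
    Finset (Matrix (Fin r) (Fin n) (ZMod 2)) :=
  univ.filter (fun P => (∀ i, hammingNorm (P i) = t) ∧ P * G = 0)

noncomputable def chi (a : ZMod 2) : ℝ := if a = 0 then 1 else -1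

lemma zmod2_cases (a : ZMod 2) : a = 0 ∨ a = 1 := by
  revert a; decide

lemma chi_zero : chi 0 = 1 := by simp [chi]
lemma chi_one : chi 1 = -1 := by simp [chi]

lemma chi_add (a b : ZMod 2) : chi (a + b) = chi a * chi b := by
  have h11 : (1 : ZMod 2) + 1 = 0 := by decide
  rcases zmod2_cases a with rfl | rfl <;> rcases zmod2_cases b with rfl | rfl <;>
    simp [chi_zero, chi_one, h11]

lemma chi_sq (a : ZMod 2) : chi a ^ 2 = 1 := by
  rcases zmod2_cases a with rfl | rfl <;> simp [chi_zero, chi_one]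

lemma chi_abs (a : ZMod 2) : |chi a| = 1 := by
  rcases zmod2_cases a with rfl | rfl <;> simp [chi_zero, chi_one]

lemma chi_sum {ι : Type*} (s : Finset ι) (f : ι → ZMod 2) :
    chi (∑ i ∈ s, f i) = ∏ i ∈ s, chi (f i) := by
  induction s using Finset.induction_on with
  | empty => simp [chi_zero]
  | insert a s ha ih => rw [Finset.sum_insert ha, Finset.prod_insert ha, chi_add, ih]

lemma sum_zmod2 {R : Type*} [AddCommMonoid R] (f : ZMod 2 → R) : ∑ a, f a = f 0 + f 1 := by
  exact Fin.sum_univ_two f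

/-- the signed bias of a vector -/
noncomputable def ms {n : ℕ} (v : Fin n → ZMod 2) : ℝ := ∑ i, chi (v i)

/-- Krawtchouk-type sums -/
noncomputable def Ek {n : ℕ} (k : ℕ) (v : Fin n → ZMod 2) : ℝ :=
  ∑ p ∈ univ.filter (fun p : Fin n → ZMod 2 => hammingNorm p = k), chi (p ⬝ᵥ v)

open Polynomial in
lemma poly_ode {ι : Type*} (s : Finset ι) (a : ι → ℝ) (ha : ∀ i, a i ^ 2 = 1) :
    derivative (∏ i ∈ s, (1 + C (a i) * X)) - X * (X * derivative (∏ i ∈ s, (1 + C (a i) * X)))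
      = C (∑ i ∈ s, a i) * (∏ i ∈ s, (1 + C (a i) * X))
        - X * (C (s.card : ℝ) * (∏ i ∈ s, (1 + C (a i) * X))) := by
  induction s using Finset.induction_on with
  | empty => simp
  | insert b s hb ih =>
    rw [Finset.prod_insert hb, Finset.sum_insert hb, Finset.card_insert_of_notMem hb]
    set F := ∏ i ∈ s, (1 + C (a i) * X)
    have h2 : (C (a b) : ℝ[X]) ^ 2 = 1 := by rw [← C_pow, ha, C_1]
    rw [derivative_mul]
    simp only [derivative_add, derivative_one, derivative_C_mul, derivative_X, Nat.cast_add,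
      Nat.cast_one, C_add, C_1, mul_one, zero_add]
    linear_combination (1 + C (a b) * X) * ih - (X * F) * h2

open Polynomial in
lemma Ek_coeff {n : ℕ} (k : ℕ) (v : Fin n → ZMod 2) :
    Ek k v = (∏ i : Fin n, (1 + C (chi (v i)) * X) : ℝ[X]).coeff k := by
  have h1 : (∏ i : Fin n, (1 + C (chi (v i)) * X) : ℝ[X])
      = ∏ i : Fin n, ∑ b : ZMod 2, (C (chi (b * v i)) * X ^ (if b = 0 then 0 else 1)) := by
    refine Finset.prod_congr rfl fun i _ => ?_
    rw [sum_zmod2]; simp [chi_zero]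
  have h2 : (∏ i : Fin n, (1 + C (chi (v i)) * X) : ℝ[X])
      = ∑ p : Fin n → ZMod 2, C (chi (p ⬝ᵥ v)) * X ^ (hammingNorm p) := by
    rw [h1, Finset.prod_univ_sum, Fintype.piFinset_univ]
    refine Finset.sum_congr rfl fun p _ => ?_
    rw [Finset.prod_mul_distrib, dotProduct, chi_sum, map_prod, Finset.prod_pow_eq_pow_sum]
    congr 2
    rw [hammingNorm, Finset.card_filter]
    refine Finset.sum_congr rfl fun i _ => ?_
    by_cases h : p i = 0 <;> simp [h]
  rw [h2, finsetSum_coeff, Ek, Finset.sum_filter]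
  refine Finset.sum_congr rfl fun p _ => ?_
  rw [coeff_C_mul, coeff_X_pow]
  by_cases h : hammingNorm p = k
  · simp [h]
  · simp [h, Ne.symm h]

lemma Ek_rec {n : ℕ} (k : ℕ) (v : Fin n → ZMod 2) :
    ((k : ℝ) + 2) * Ek (k + 2) v = ms v * Ek (k + 1) v - ((n : ℝ) - k) * Ek k v := by
  have h := poly_ode (univ : Finset (Fin n)) (fun i => chi (v i)) (fun i => chi_sq _)
  have h' := congrArg (fun q => Polynomial.coeff q (k + 1)) h
  simp only [Ek_coeff]
  simp only [Polynomial.coeff_sub, Polynomial.coeff_X_mul, Polynomial.coeff_C_mul,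
    Polynomial.coeff_derivative, Finset.card_univ, Fintype.card_fin] at h'
  rcases k with _ | k
  · simp only [Polynomial.coeff_X_mul_zero] at h'
    push_cast at h' ⊢
    rw [ms]; linarith
  · simp only [Polynomial.coeff_X_mul, Polynomial.coeff_derivative] at h'
    push_cast at h' ⊢
    rw [ms]; linarith

lemma Ek_zero {n : ℕ} (v : Fin n → ZMod 2) : Ek 0 v = 1 := by
  rw [Ek_coeff, Polynomial.coeff_zero_eq_eval_zero, Polynomial.eval_prod]; simp

lemma Ek_one {n : ℕ} (v : Fin n → ZMod 2) : Ek 1 v = ms v := by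
  have h := poly_ode (univ : Finset (Fin n)) (fun i => chi (v i)) (fun i => chi_sq _)
  have h' := congrArg (fun q => Polynomial.coeff q 0) h
  have h0 := Ek_zero v
  rw [Ek_coeff] at h0 ⊢
  simp only [Polynomial.coeff_sub, Polynomial.coeff_X_mul_zero, Polynomial.coeff_C_mul,
    Polynomial.coeff_derivative, h0] at h'
  rw [ms]; push_cast at h'; linarith

lemma Ek_at_zero {n : ℕ} (k : ℕ) : Ek k (0 : Fin n → ZMod 2) = n.choose k := by
  rw [Ek_coeff]
  simp [chi_zero, Polynomial.coeff_one_add_X_pow]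

lemma Ek_bound {n : ℕ} (t : ℕ) (v : Fin n → ZMod 2) (D : ℝ) (hD : 0 < D) (htn : t ≤ n)
    (h : |ms v| * D + t ≤ ((n : ℝ) - t) * D ^ 2) :
    |Ek t v| ≤ n.choose t * D ^ t := by
  have ht0 : (0 : ℝ) ≤ t := Nat.cast_nonneg _
  have key : ∀ k : ℕ, k + 1 ≤ t → |Ek k v| ≤ n.choose k * D ^ k ∧
      |Ek (k + 1) v| ≤ n.choose (k + 1) * D ^ (k + 1) := by
    intro k
    induction k with
    | zero =>
      intro _
      refine ⟨by simp [Ek_zero], ?_⟩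
      simp only [zero_add, Ek_one, Nat.choose_one_right, pow_one]
      have : |ms v| * D ≤ (n * D) * D := by nlinarith [sq_nonneg D]
      exact le_of_mul_le_mul_right this hD
    | succ k ih =>
      intro hk
      obtain ⟨h1, h2⟩ := ih (by omega)
      refine ⟨h2, ?_⟩
      have hr := Ek_rec k v
      have hc1 : ((n.choose (k + 1 + 1) : ℕ) : ℝ) * ((k : ℝ) + 2)
          = n.choose (k + 1) * ((n : ℝ) - (k + 1)) := by
        have := Nat.choose_succ_right_eq n (k + 1)
        have h3 : ((n - (k + 1) : ℕ) : ℝ) = (n : ℝ) - (k + 1) := by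
          rw [Nat.cast_sub (by omega)]; push_cast; ring
        rw [← h3, ← Nat.cast_mul, ← this]; push_cast; ring
      have hc0 : ((n.choose (k + 1) : ℕ) : ℝ) * ((k : ℝ) + 1)
          = n.choose k * ((n : ℝ) - k) := by
        have := Nat.choose_succ_right_eq n k
        have h3 : ((n - k : ℕ) : ℝ) = (n : ℝ) - k := by
          rw [Nat.cast_sub (by omega)]
        rw [← h3, ← Nat.cast_mul, ← this]; push_cast; ring
      have hkt : (k : ℝ) + 2 ≤ t := by exact_mod_cast hk
      have hnt : (t : ℝ) ≤ n := by exact_mod_cast htn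
      have hnk : (0 : ℝ) ≤ (n : ℝ) - k := by linarith
      have hk0 : (0 : ℝ) ≤ k := Nat.cast_nonneg _
      have h5 : ((k : ℝ) + 2) * |Ek (k + 2) v|
          ≤ |ms v| * |Ek (k + 1) v| + ((n : ℝ) - k) * |Ek k v| := by
        rw [← abs_of_nonneg (by linarith : (0 : ℝ) ≤ (k : ℝ) + 2), ← abs_mul, hr]
        refine (abs_sub _ _).trans ?_
        rw [abs_mul, abs_mul, abs_of_nonneg hnk]
      have h6 : |ms v| * |Ek (k + 1) v| ≤ |ms v| * (n.choose (k + 1) * D ^ (k + 1)) :=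
        mul_le_mul_of_nonneg_left h2 (abs_nonneg _)
      have h7 : ((n : ℝ) - k) * |Ek k v| ≤ ((n : ℝ) - k) * (n.choose k * D ^ k) :=
        mul_le_mul_of_nonneg_left h1 hnk
      have h8 : |ms v| * D + ((k : ℝ) + 1) ≤ ((n : ℝ) - (k + 1)) * D ^ 2 := by
        nlinarith [sq_nonneg D]
      have h9 : (n.choose (k + 1) * D ^ k : ℝ) * (|ms v| * D + ((k : ℝ) + 1))
          ≤ (n.choose (k + 1) * D ^ k : ℝ) * (((n : ℝ) - (k + 1)) * D ^ 2) :=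
        mul_le_mul_of_nonneg_left h8 (by positivity)
      have h10 : ((k : ℝ) + 2) * |Ek (k + 2) v|
          ≤ ((k : ℝ) + 2) * (n.choose (k + 1 + 1) * D ^ (k + 1 + 1)) := by
        calc _ ≤ _ := h5
          _ ≤ |ms v| * (n.choose (k + 1) * D ^ (k + 1)) + ((n : ℝ) - k) * (n.choose k * D ^ k) :=
            add_le_add h6 h7
          _ = (n.choose (k + 1) * D ^ k : ℝ) * (|ms v| * D + ((k : ℝ) + 1)) := by
            linear_combination (-(D ^ k)) * hc0
          _ ≤ _ := h9
          _ = _ := by linear_combination (-(D ^ (k + 2))) * hc1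
      exact le_of_mul_le_mul_left h10 (by linarith)
  rcases t with _ | t
  · simp [Ek_zero]
  · exact (key t le_rfl).2

lemma chi_sum_all {g : ℕ} (w : Fin g → ZMod 2) :
    ∑ z : Fin g → ZMod 2, chi (w ⬝ᵥ z) = if w = 0 then (2 : ℝ) ^ g else 0 := by
  have h : ∑ z : Fin g → ZMod 2, chi (w ⬝ᵥ z) = ∏ j : Fin g, ∑ b : ZMod 2, chi (w j * b) := by
    rw [Finset.prod_univ_sum, Fintype.piFinset_univ]
    refine Finset.sum_congr rfl fun z _ => ?_
    rw [dotProduct, chi_sum]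
  rw [h]
  split_ifs with hw
  · subst hw
    simp only [Pi.zero_apply, zero_mul, chi_zero, sum_zmod2]
    norm_num
  · obtain ⟨j, hj⟩ := Function.ne_iff.mp hw
    have hj1 : w j = 1 := (zmod2_cases (w j)).resolve_left hj
    refine Finset.prod_eq_zero (Finset.mem_univ j) ?_
    rw [sum_zmod2, hj1]; simp [chi_zero, chi_one]

/-- admissible rows -/
noncomputable def Srow (t n g : ℕ) (G : Matrix (Fin n) (Fin g) (ZMod 2)) :
    Finset (Fin n → ZMod 2) :=
  univ.filter (fun p => hammingNorm p = t ∧ Matrix.vecMul p G = 0)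

lemma fourier_S {t n g : ℕ} (G : Matrix (Fin n) (Fin g) (ZMod 2)) (y : Fin n → ZMod 2) :
    (2 : ℝ) ^ g * ∑ p ∈ Srow t n g G, chi (p ⬝ᵥ y)
      = ∑ z : Fin g → ZMod 2, Ek t (y + G.mulVec z) := by
  simp only [Ek]
  rw [Finset.sum_comm, Srow, Finset.mul_sum, ← Finset.filter_filter, Finset.sum_filter]
  refine Finset.sum_congr rfl fun p _ => ?_
  have h : ∀ z : Fin g → ZMod 2, chi (p ⬝ᵥ (y + G.mulVec z))
      = chi (p ⬝ᵥ y) * chi (Matrix.vecMul p G ⬝ᵥ z) := by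
    intro z
    rw [dotProduct_add, chi_add, Matrix.dotProduct_mulVec]
  simp only [h]
  rw [← Finset.mul_sum, chi_sum_all]
  split_ifs <;> ring

lemma ms_add {n : ℕ} (u v : Fin n → ZMod 2) : ms (u + v) = ∑ i, chi (u i) * chi (v i) := by
  simp [ms, chi_add]

lemma abs_ms_le {n : ℕ} (u : Fin n → ZMod 2) : |ms u| ≤ n := by
  refine (Finset.abs_sum_le_sum_abs _ _).trans ?_
  simp [chi_abs]

lemma bessel {n g : ℕ} (G : Matrix (Fin n) (Fin g) (ZMod 2)) (η : ℝ) (hη : 0 ≤ η)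
    (hG : ∀ z : Fin g → ZMod 2, z ≠ 0 → |ms (G.mulVec z)| ≤ η * n)
    (y : Fin n → ZMod 2) (B : Finset (Fin g → ZMod 2)) :
    ∑ z ∈ B, ms (y + G.mulVec z) ^ 2 ≤ (n : ℝ) ^ 2 * (1 + η * B.card) := by
  set c : (Fin g → ZMod 2) → ℝ := fun z => ms (y + G.mulVec z) with hc
  set S := ∑ z ∈ B, c z ^ 2 with hS
  have hS0 : 0 ≤ S := Finset.sum_nonneg fun z _ => sq_nonneg _
  set w : Fin n → ℝ := fun i => ∑ z ∈ B, c z * chi (G.mulVec z i) with hw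
  have e1 : S = ∑ i, chi (y i) * w i := by
    simp only [hS, hw, Finset.mul_sum]
    rw [Finset.sum_comm]
    refine Finset.sum_congr rfl fun z _ => ?_
    rw [sq]
    conv_lhs => rhs; rw [hc]
    simp only [ms_add, Finset.mul_sum]
    refine Finset.sum_congr rfl fun i _ => ?_
    ring
  have e2 : S ^ 2 ≤ n * ∑ i, w i ^ 2 := by
    rw [e1]
    refine (Finset.sum_mul_sq_le_sq_mul_sq _ _ _).trans ?_
    simp [chi_sq]
  have e3 : ∑ i, w i ^ 2 = ∑ z ∈ B, ∑ z' ∈ B, c z * c z' * ms (G.mulVec (z + z')) := by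
    simp only [hw, sq, Finset.sum_mul_sum]
    rw [Finset.sum_comm]
    refine Finset.sum_congr rfl fun z _ => ?_
    rw [Finset.sum_comm]
    refine Finset.sum_congr rfl fun z' _ => ?_
    rw [Matrix.mulVec_add, ms_add, Finset.mul_sum]
    refine Finset.sum_congr rfl fun i _ => ?_
    ring
  have e4 : ∑ i, w i ^ 2 ≤ ∑ z ∈ B, ∑ z' ∈ B,
      ((if z = z' then c z ^ 2 * n else 0) + |c z| * |c z'| * (η * n)) := by
    rw [e3]
    refine Finset.sum_le_sum fun z _ => Finset.sum_le_sum fun z' _ => ?_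
    have hn0 : 0 ≤ |c z| * |c z'| * (η * n) := by positivity
    split_ifs with h
    · subst h
      have h1 : ms (G.mulVec (z + z)) ≤ n := (le_abs_self _).trans (abs_ms_le _)
      have : c z * c z * ms (G.mulVec (z + z)) ≤ c z * c z * n :=
        mul_le_mul_of_nonneg_left h1 (mul_self_nonneg _)
      nlinarith
    · have hz : z + z' ≠ 0 := by
        intro h0; apply h
        have h2 : z' + z' = 0 := by
          ext j; simp only [Pi.add_apply, Pi.zero_apply]
          rcases zmod2_cases (z' j) with h | h <;> rw [h] <;> decide
        calc z = z + (z' + z') := by rw [h2, add_zero]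
          _ = z' := by rw [← add_assoc, h0, zero_add]
      rw [zero_add]
      refine (le_abs_self _).trans ?_
      rw [abs_mul, abs_mul]
      exact mul_le_mul_of_nonneg_left (hG _ hz) (by positivity)
  have e5 : ∑ z ∈ B, ∑ z' ∈ B,
      ((if z = z' then c z ^ 2 * n else 0) + |c z| * |c z'| * (η * n))
      = S * n + (∑ z ∈ B, |c z|) ^ 2 * (η * n) := by
    simp only [Finset.sum_add_distrib]
    congr 1
    · rw [hS, Finset.sum_mul]
      refine Finset.sum_congr rfl fun z hz => ?_
      rw [Finset.sum_ite_eq]; simp [hz]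
    · rw [sq, Finset.sum_mul_sum]
      simp only [Finset.sum_mul]
  have e6 : (∑ z ∈ B, |c z|) ^ 2 ≤ B.card * S := by
    refine sq_sum_le_card_mul_sum_sq.trans ?_
    simp [hS, sq_abs]
  have hn : (0 : ℝ) ≤ n := Nat.cast_nonneg _
  have e7 : S ^ 2 ≤ S * ((n : ℝ) ^ 2 * (1 + η * B.card)) := by
    have : ∑ i, w i ^ 2 ≤ S * n + (B.card * S) * (η * n) := by
      refine e4.trans (e5.le.trans ?_)
      have := mul_le_mul_of_nonneg_right e6 (by positivity : 0 ≤ η * n)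
      linarith
    have := mul_le_mul_of_nonneg_left this hn
    nlinarith
  rcases hS0.eq_or_lt with h0 | h0
  · rw [← h0]; positivity
  · rw [sq] at e7; exact le_of_mul_le_mul_left e7 h0

lemma sum_exp_ms {n : ℕ} (s : ℝ) :
    ∑ v : Fin n → ZMod 2, Real.exp (s * ms v) = (2 * Real.cosh s) ^ n := by
  have : (2 * Real.cosh s) ^ n = ∏ _i : Fin n, ∑ b : ZMod 2, Real.exp (s * chi b) := by
    simp [sum_zmod2, chi_zero, chi_one, Real.cosh_eq]
    congr 1
    ring
  rw [this, Finset.prod_univ_sum, Fintype.piFinset_univ]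
  refine Finset.sum_congr rfl fun v _ => ?_
  rw [ms, Finset.mul_sum, Real.exp_sum]

lemma card_ms_ge {n : ℕ} (s a : ℝ) (T : Finset (Fin n → ZMod 2))
    (hT : ∀ v ∈ T, a ≤ s * ms v) :
    (T.card : ℝ) ≤ (2 * Real.cosh s) ^ n * Real.exp (-a) := by
  have h1 : (T.card : ℝ) * Real.exp a ≤ (2 * Real.cosh s) ^ n := by
    rw [← sum_exp_ms, ← nsmul_eq_mul, ← Finset.sum_const]
    refine (Finset.sum_le_sum fun v hv => Real.exp_le_exp.mpr (hT v hv)).trans ?_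
    exact Finset.sum_le_sum_of_subset_of_nonneg (Finset.subset_univ _)
      (fun v _ _ => (Real.exp_pos _).le)
  rw [Real.exp_neg, ← div_eq_mul_inv, le_div_iff₀ (Real.exp_pos _)]
  exact h1

/-- Gaussian-type bound. -/
lemma card_ms_gauss {n : ℕ} (s c : ℝ) (T : Finset (Fin n → ZMod 2))
    (hT : ∀ v ∈ T, c ≤ s * ms v) :
    (T.card : ℝ) ≤ 2 ^ n * Real.exp (n * (s ^ 2 / 2) - c) := by
  refine (card_ms_ge s c T hT).trans ?_
  rw [mul_pow, sub_eq_add_neg, Real.exp_add, ← mul_assoc, Real.exp_nat_mul]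
  gcongr
  exact Real.cosh_le_exp_half_sq s

lemma card_ms_tail {n : ℕ} (s c : ℝ) (hs : 0 ≤ s) :
    ((univ.filter (fun v : Fin n → ZMod 2 => c ≤ |ms v|)).card : ℝ)
      ≤ 2 * (2 ^ n * Real.exp (n * (s ^ 2 / 2) - s * c)) := by
  have h1 := card_ms_gauss s (s * c) (univ.filter (fun v : Fin n → ZMod 2 => c ≤ ms v))
    (fun v hv => mul_le_mul_of_nonneg_left (Finset.mem_filter.mp hv).2 hs)
  have h2 := card_ms_gauss (-s) (s * c) (univ.filter (fun v : Fin n → ZMod 2 => c ≤ - ms v))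
    (fun v hv => by
      have := mul_le_mul_of_nonneg_left (Finset.mem_filter.mp hv).2 hs
      linarith)
  rw [neg_sq] at h2
  have h3 : (univ.filter (fun v : Fin n → ZMod 2 => c ≤ |ms v|)) ⊆
      univ.filter (fun v : Fin n → ZMod 2 => c ≤ ms v) ∪
      univ.filter (fun v : Fin n → ZMod 2 => c ≤ - ms v) := by
    intro v hv
    simp only [Finset.mem_filter, Finset.mem_univ, true_and, Finset.mem_union] at hv ⊢
    exact le_abs.mp hv
  have h4 : ((univ.filter (fun v : Fin n → ZMod 2 => c ≤ |ms v|)).card : ℝ) ≤ _ :=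
    Nat.cast_le.mpr ((Finset.card_le_card h3).trans (Finset.card_union_le _ _))
  push_cast at h4
  linarith

lemma card_ker_mul {r n : ℕ} (P : Matrix (Fin r) (Fin n) (ZMod 2)) :
    (univ.filter (fun y : Fin n → ZMod 2 => P.mulVec y = 0)).card * 2 ^ P.rank = 2 ^ n := by
  have h1 : (univ.filter (fun y : Fin n → ZMod 2 => P.mulVec y = 0)).card
      = Nat.card (LinearMap.ker P.mulVecLin) := by
    rw [Nat.card_eq_fintype_card, ← Fintype.card_coe]
    refine Fintype.card_congr (Equiv.subtypeEquivRight fun y => ?_)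
    simp [LinearMap.mem_ker]
  have h2 := Module.natCard_eq_pow_finrank (K := ZMod 2) (V := LinearMap.ker P.mulVecLin)
  have h3 := LinearMap.finrank_range_add_finrank_ker P.mulVecLin
  rw [h1, h2, Nat.card_zmod, ← pow_add, Matrix.rank, add_comm, h3]
  simp

lemma card_rows {r n : ℕ} (Q : Finset (Matrix (Fin r) (Fin n) (ZMod 2)))
    (S : Finset (Fin n → ZMod 2)) (h : ∀ P, P ∈ Q ↔ ∀ i, P i ∈ S) : Q.card = S.card ^ r := by
  have h1 : Q = (Fintype.piFinset (fun _ : Fin r => S)).map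
      (Matrix.of : (Fin r → Fin n → ZMod 2) ≃ Matrix (Fin r) (Fin n) (ZMod 2)).toEmbedding := by
    ext P
    rw [h, Finset.mem_map_equiv, Fintype.mem_piFinset]
    rfl
  rw [h1, Finset.card_map, Fintype.card_piFinset]; simp

lemma mem_Pset {t r n g : ℕ} (G : Matrix (Fin n) (Fin g) (ZMod 2))
    (P : Matrix (Fin r) (Fin n) (ZMod 2)) :
    P ∈ PsetOf t r n g G ↔ ∀ i, P i ∈ Srow t n g G := by
  simp only [PsetOf, Srow, Finset.mem_filter, Finset.mem_univ, true_and]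
  rw [forall_and]
  refine and_congr_right fun _ => ?_
  constructor
  · intro h i
    ext j
    exact congrFun (congrFun h i) j
  · intro h
    ext i j
    exact congrFun (h i) j

lemma Pset_card {t r n g : ℕ} (G : Matrix (Fin n) (Fin g) (ZMod 2)) :
    (PsetOf t r n g G).card = (Srow t n g G).card ^ r :=
  card_rows _ _ (mem_Pset G)

lemma Pset_sum {t r n g : ℕ} (G : Matrix (Fin n) (Fin g) (ZMod 2)) :
    ∑ P ∈ PsetOf t r n g G, (univ.filter (fun y : Fin n → ZMod 2 => P.mulVec y = 0)).card
      = ∑ y : Fin n → ZMod 2, ((Srow t n g G).filter (fun p => p ⬝ᵥ y = 0)).card ^ r := by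
  simp only [Finset.card_filter _ (univ : Finset (Fin n → ZMod 2))]
  rw [Finset.sum_comm]
  refine Finset.sum_congr rfl fun y _ => ?_
  rw [← Finset.card_filter]
  refine card_rows _ _ fun P => ?_
  simp only [Finset.mem_filter]
  rw [forall_and, mem_Pset]
  refine and_congr_right fun _ => ?_
  exact funext_iff

lemma two_q {t n g : ℕ} (G : Matrix (Fin n) (Fin g) (ZMod 2)) (y : Fin n → ZMod 2) :
    2 * (((Srow t n g G).filter (fun p => p ⬝ᵥ y = 0)).card : ℝ)
      = (Srow t n g G).card + ∑ p ∈ Srow t n g G, chi (p ⬝ᵥ y) := by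
  rw [Finset.card_filter, Finset.card_eq_sum_ones]
  push_cast
  rw [Finset.mul_sum, ← Finset.sum_add_distrib]
  refine Finset.sum_congr rfl fun p _ => ?_
  rcases zmod2_cases (p ⬝ᵥ y) with h | h <;> rw [h] <;> simp [chi_zero, chi_one]
  norm_num

lemma bad_count {t r n g : ℕ} (G : Matrix (Fin n) (Fin g) (ZMod 2)) :
    (2 : ℝ) ^ n * (((PsetOf t r n g G).filter (fun P => ¬ P.rank = r)).card : ℝ)
      + 2 ^ n * ((Srow t n g G).card : ℝ) ^ r
      ≤ ∑ y : Fin n → ZMod 2,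
        (2 * (((Srow t n g G).filter (fun p => p ⬝ᵥ y = 0)).card : ℝ)) ^ r := by
  have h := congrArg (Nat.cast : ℕ → ℝ) (Pset_sum (t := t) (r := r) G)
  push_cast at h
  simp only [mul_pow]
  rw [← Finset.mul_sum, ← h, ← Nat.cast_pow, ← Pset_card, Finset.card_filter,
    Finset.card_eq_sum_ones]
  push_cast
  rw [Finset.mul_sum, Finset.mul_sum, Finset.mul_sum, ← Finset.sum_add_distrib]
  refine Finset.sum_le_sum fun P _ => ?_
  have hk := congrArg (Nat.cast : ℕ → ℝ) (card_ker_mul P)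
  push_cast at hk
  have hle : P.rank ≤ r := P.rank_le_height
  set c : ℝ := ((univ.filter (fun y : Fin n → ZMod 2 => P.mulVec y = 0)).card : ℝ)
  have hc : 0 ≤ c := Nat.cast_nonneg _
  split_ifs with hbad
  · rw [hbad] at hk
    nlinarith
  · have hlt : P.rank + 1 ≤ r := by omega
    have : (2 : ℝ) ^ (P.rank + 1) ≤ 2 ^ r := pow_le_pow_right₀ (by norm_num) hlt
    rw [pow_succ] at this
    nlinarith

structure Par (n t g : ℕ) (M : ℝ) : Prop where
  hn : (n : ℝ) = M ^ 16
  hM : 4 ≤ M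
  h2g : (2 : ℝ) ^ g ≤ M ^ t
  ht : 5 * (t : ℝ) ≤ M ^ 4
  hs : (2 / M) ^ t * M ^ 16 ≤ 1 / 16
  ht4 : 4 ≤ t
  h9 : (0.9995 : ℝ) ^ (t - 4) ≤ 1 / 512

def GoodG (n g : ℕ) (M : ℝ) (G : Matrix (Fin n) (Fin g) (ZMod 2)) : Prop :=
  ∀ z : Fin g → ZMod 2, z ≠ 0 → |ms (G.mulVec z)| ≤ M ^ 10

lemma Par.tn {n t g : ℕ} {M : ℝ} (h : Par n t g M) : t ≤ n := by
  have h1 : (t : ℝ) ≤ n := by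
    rw [h.hn]
    have := h.ht
    have h2 : M ^ 4 ≤ M ^ 16 := pow_le_pow_right₀ (by linarith [h.hM]) (by norm_num)
    have : (0 : ℝ) ≤ t := Nat.cast_nonneg _
    linarith
  exact_mod_cast h1

lemma Ek_bound' {n t g : ℕ} {M : ℝ} (h : Par n t g M) (v : Fin n → ZMod 2) :
    |Ek t v| ≤ n.choose t * (|ms v| / n + 1 / M ^ 6) ^ t := by
  have hM0 : 0 < M := by linarith [h.hM]
  have hn0 : (0 : ℝ) < n := by rw [h.hn]; positivity
  set δ := |ms v| / n with hδ
  have hδ0 : 0 ≤ δ := by positivity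
  have hδ1 : δ ≤ 1 := by rw [hδ, div_le_one hn0]; exact abs_ms_le v
  have hm : |ms v| = n * δ := by rw [hδ]; field_simp
  set κ : ℝ := 1 / M ^ 6 with hκ
  have hκ0 : 0 < κ := by positivity
  have hM6 : 1 ≤ M ^ 6 := one_le_pow₀ (by linarith [h.hM])
  have hκ1 : κ ≤ 1 := by rw [hκ, div_le_one (by positivity)]; exact hM6
  have hnκ : (n : ℝ) * κ ^ 2 = M ^ 4 := by rw [h.hn, hκ]; field_simp
  refine Ek_bound t v (δ + κ) (by positivity) h.tn ?_
  rw [hm]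
  have ht := h.ht
  have ht0 : (0 : ℝ) ≤ t := Nat.cast_nonneg _
  have h1 : (δ + κ) ^ 2 ≤ 4 := by nlinarith
  have h2 : (t : ℝ) * (δ + κ) ^ 2 ≤ t * 4 := mul_le_mul_of_nonneg_left h1 ht0
  have h3 : (n : ℝ) * κ ^ 2 ≤ n * κ * (δ + κ) := by
    have : 0 ≤ (n : ℝ) * κ * δ := by positivity
    nlinarith
  nlinarith

lemma sm_sum {n t g : ℕ} {M : ℝ} (h : Par n t g M) (G : Matrix (Fin n) (Fin g) (ZMod 2))
    (y : Fin n → ZMod 2) (B : Finset (Fin g → ZMod 2))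
    (hB : ∀ z ∈ B, |ms (y + G.mulVec z)| ≤ M ^ 14) :
    ∑ z ∈ B, |Ek t (y + G.mulVec z)| ≤ n.choose t * (2 / M) ^ t := by
  have hM0 : 0 < M := by linarith [h.hM]
  have hM1 : 1 ≤ M := by linarith [h.hM]
  have h1 : ∀ z ∈ B, |Ek t (y + G.mulVec z)| ≤ n.choose t * (2 / M ^ 2) ^ t := by
    intro z hz
    refine (Ek_bound' h _).trans ?_
    gcongr
    have e1 : |ms (y + G.mulVec z)| / n ≤ 1 / M ^ 2 := by
      rw [h.hn, div_le_div_iff₀ (by positivity) (by positivity)]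
      calc _ ≤ M ^ 14 * M ^ 2 := by gcongr; exact hB z hz
        _ = _ := by ring
    have e2 : 1 / M ^ 6 ≤ 1 / M ^ 2 := by
      apply one_div_le_one_div_of_le (by positivity)
      exact pow_le_pow_right₀ hM1 (by norm_num)
    calc _ ≤ 1 / M ^ 2 + 1 / M ^ 2 := add_le_add e1 e2
      _ = _ := by ring
  have hcard : (B.card : ℝ) ≤ 2 ^ g := by
    have := Finset.card_le_univ B
    rw [Fintype.card_fun, ZMod.card, Fintype.card_fin] at this
    exact_mod_cast this
  calc _ ≤ ∑ z ∈ B, (n.choose t * (2 / M ^ 2) ^ t : ℝ) := Finset.sum_le_sum h1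
    _ = B.card * (n.choose t * (2 / M ^ 2) ^ t : ℝ) := by rw [Finset.sum_const, nsmul_eq_mul]
    _ ≤ M ^ t * (n.choose t * (2 / M ^ 2) ^ t : ℝ) := by
      gcongr; exact hcard.trans h.h2g
    _ = n.choose t * (M * (2 / M ^ 2)) ^ t := by rw [mul_pow]; ring
    _ = _ := by congr 2; field_simp

lemma Par.small {n t g : ℕ} {M : ℝ} (h : Par n t g M) : (2 / M) ^ t ≤ 1 / (16 * M ^ 4) := by
  have hM0 : 0 < M := by linarith [h.hM]
  rw [le_div_iff₀ (by positivity)]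
  have := h.hs
  have h2 : M ^ 4 ≤ M ^ 16 := pow_le_pow_right₀ (by linarith [h.hM]) (by norm_num)
  have : (2 / M) ^ t * M ^ 4 ≤ (2 / M) ^ t * M ^ 16 := by gcongr
  linarith

lemma S_lower {n t g : ℕ} {M : ℝ} (h : Par n t g M) (G : Matrix (Fin n) (Fin g) (ZMod 2))
    (hG : GoodG n g M G) :
    (n.choose t : ℝ) ≤ 2 * (2 ^ g * (Srow t n g G).card) := by
  have hM1 : 1 ≤ M := by linarith [h.hM]
  have hf := fourier_S (t := t) G 0
  simp only [dotProduct_zero, chi_zero, Finset.sum_const, nsmul_eq_mul, mul_one] at hf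
  rw [hf, ← Finset.add_sum_erase _ _ (Finset.mem_univ (0 : Fin g → ZMod 2))]
  rw [Matrix.mulVec_zero, add_zero, Ek_at_zero]
  have h1 := sm_sum h G 0 (univ.erase 0) (by
    intro z hz
    rw [zero_add]
    exact (hG z (Finset.ne_of_mem_erase hz)).trans (pow_le_pow_right₀ hM1 (by norm_num)))
  have h2 := (Finset.abs_sum_le_sum_abs (fun z => Ek t ((0 : Fin n → ZMod 2) + G.mulVec z))
    (univ.erase 0)).trans h1
  have h3 := neg_le_of_abs_le h2
  have h4 : (2 / M) ^ t ≤ 1 / 2 := by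
    refine h.small.trans ?_
    apply one_div_le_one_div_of_le (by norm_num)
    have : 1 ≤ M ^ 4 := one_le_pow₀ hM1
    linarith
  have h5 : (n.choose t : ℝ) * (2 / M) ^ t ≤ n.choose t * (1 / 2) := by gcongr
  linarith

lemma S_pos {n t g : ℕ} {M : ℝ} (h : Par n t g M) (G : Matrix (Fin n) (Fin g) (ZMod 2))
    (hG : GoodG n g M G) : (0 : ℝ) < (Srow t n g G).card := by
  have h1 := S_lower h G hG
  have h2 : (0 : ℝ) < n.choose t := by exact_mod_cast Nat.choose_pos h.tn
  by_contra h3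
  have h4 : ((Srow t n g G).card : ℝ) = 0 := le_antisymm (not_lt.mp h3) (Nat.cast_nonneg _)
  rw [h4] at h1
  linarith

/-- transfer of bounds on the sum of Krawtchouk values -/
lemma lam_of_sum {n t g : ℕ} {M : ℝ} (h : Par n t g M) (G : Matrix (Fin n) (Fin g) (ZMod 2))
    (hG : GoodG n g M G) (y : Fin n → ZMod 2) (X : ℝ) (hX : 0 ≤ X)
    (hs : ∑ z : Fin g → ZMod 2, |Ek t (y + G.mulVec z)| ≤ n.choose t * X) :
    ∑ p ∈ Srow t n g G, chi (p ⬝ᵥ y) ≤ (Srow t n g G).card * (2 * X) := by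
  have hf := fourier_S (t := t) G y
  have h1 := (le_abs_self _).trans
    (Finset.abs_sum_le_sum_abs (fun z => Ek t (y + G.mulVec z)) univ)
  have h2 := S_lower h G hG
  have h3 := mul_le_mul_of_nonneg_right h2 hX
  have h4 : (0 : ℝ) < 2 ^ g := by positivity
  refine le_of_mul_le_mul_left ?_ h4
  rw [hf]
  linarith

lemma lam_bulk {n t g : ℕ} {M : ℝ} (h : Par n t g M) (G : Matrix (Fin n) (Fin g) (ZMod 2))
    (hG : GoodG n g M G) (y : Fin n → ZMod 2)
    (hy : ∀ z : Fin g → ZMod 2, |ms (y + G.mulVec z)| ≤ M ^ 14) :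
    ∑ p ∈ Srow t n g G, chi (p ⬝ᵥ y) ≤ (Srow t n g G).card * (2 * (2 / M) ^ t) := by
  have hM0 : 0 < M := by linarith [h.hM]
  exact lam_of_sum h G hG y _ (by positivity) (sm_sum h G y univ fun z _ => hy z)

lemma lam_mid {n t g : ℕ} {M : ℝ} (h : Par n t g M) (G : Matrix (Fin n) (Fin g) (ZMod 2))
    (hG : GoodG n g M G) (y : Fin n → ZMod 2) (m : ℝ)
    (hy : ∀ z : Fin g → ZMod 2, |ms (y + G.mulVec z)| ≤ m)
    (hm1 : M ^ 14 ≤ m) (hm2 : m ≤ 0.999 * n) :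
    ∑ p ∈ Srow t n g G, chi (p ⬝ᵥ y) ≤ (Srow t n g G).card * ((m / n) ^ 2 / 4) := by
  have hM0 : 0 < M := by linarith [h.hM]
  have hM1 : 1 ≤ M := by linarith [h.hM]
  have hn0 : (0 : ℝ) < n := by rw [h.hn]; positivity
  set δ := m / n with hδ
  have hδ1 : 1 / M ^ 2 ≤ δ := by
    rw [hδ, h.hn, div_le_div_iff₀ (by positivity) (by positivity)]
    calc _ = M ^ 14 * M ^ 2 := by ring
      _ ≤ _ := by gcongr
  have hδ0 : 0 < δ := lt_of_lt_of_le (by positivity) hδ1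
  have hδ2 : δ ≤ 0.999 := by rw [hδ, div_le_iff₀ hn0]; exact hm2
  set κ : ℝ := 1 / M ^ 6 with hκ
  have hκ0 : 0 < κ := by positivity
  have hM6 : (4 : ℝ) ^ 6 ≤ M ^ 6 := pow_le_pow_left₀ (by norm_num) h.hM 6
  have hκ1 : κ ≤ 0.0005 := by
    rw [hκ, div_le_iff₀ (by positivity)]; norm_num at hM6 ⊢; linarith
  have hκM : κ ≤ 1 / M ^ 2 := by
    apply one_div_le_one_div_of_le (by positivity)
    exact pow_le_pow_right₀ hM1 (by norm_num)
  -- the big set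
  set B : Finset (Fin g → ZMod 2) := univ.filter (fun z => M ^ 14 < |ms (y + G.mulVec z)|) with hB
  have hbes := bessel G κ hκ0.le (fun z hz => by
    refine (hG z hz).trans (le_of_eq ?_)
    rw [hκ, h.hn]; field_simp) y B
  set b : ℝ := (B.card : ℝ) with hb
  have hb0 : 0 ≤ b := Nat.cast_nonneg _
  have hlow : b * M ^ 28 ≤ ∑ z ∈ B, ms (y + G.mulVec z) ^ 2 := by
    rw [hb, ← nsmul_eq_mul, ← Finset.sum_const]
    refine Finset.sum_le_sum fun z hz => ?_
    rw [← sq_abs (ms _)]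
    have := (Finset.mem_filter.mp hz).2
    calc M ^ 28 = (M ^ 14) ^ 2 := by ring
      _ ≤ _ := by gcongr
  have hbk : κ * b ≤ 1 := by
    have h1 : b * M ^ 28 ≤ (M ^ 16) ^ 2 * (1 + κ * b) := by rw [← h.hn]; exact hlow.trans hbes
    have h2' : κ * M ^ 6 = 1 := by rw [hκ]; exact one_div_mul_cancel (by positivity)
    have h2 : b = κ * b * M ^ 6 := by linear_combination (-b) * h2'
    set x := κ * b with hx
    rw [h2] at h1
    have h3 : x * M ^ 2 ≤ 1 + x := by
      refine le_of_mul_le_mul_left ?_ (by positivity : (0 : ℝ) < M ^ 32)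
      calc _ = x * M ^ 6 * M ^ 28 := by ring
        _ ≤ _ := h1
        _ = _ := by ring
    have hx0 : 0 ≤ x := mul_nonneg hκ0.le hb0
    have hM2 : 16 ≤ M ^ 2 := by nlinarith [h.hM]
    nlinarith
  have hS : ∑ z ∈ B, (|ms (y + G.mulVec z)| / n) ^ 2 ≤ 2 := by
    simp only [div_pow, sq_abs]
    rw [← Finset.sum_div, div_le_iff₀ (by positivity)]
    have : (n : ℝ) ^ 2 * (1 + κ * b) ≤ n ^ 2 * 2 := by gcongr; linarith
    linarith
  have hbig : ∑ z ∈ B, |Ek t (y + G.mulVec z)|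
      ≤ n.choose t * ((δ + κ) ^ (t - 2) * 8) := by
    have h1 : ∀ z ∈ B, |Ek t (y + G.mulVec z)| ≤ n.choose t *
        ((δ + κ) ^ (t - 2) * (4 * (|ms (y + G.mulVec z)| / n) ^ 2)) := by
      intro z hz
      refine (Ek_bound' h _).trans ?_
      have hz1 := (Finset.mem_filter.mp hz).2
      set d := |ms (y + G.mulVec z)| / n with hd
      have hd1 : 1 / M ^ 2 ≤ d := by
        rw [hd, h.hn, div_le_div_iff₀ (by positivity) (by positivity)]
        calc _ = M ^ 14 * M ^ 2 := by ring
          _ ≤ _ := by gcongr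
      have hd0 : 0 ≤ d := by positivity
      have hd2 : d ≤ δ := by rw [hd, hδ]; gcongr; exact hy z
      have ht : t = (t - 2) + 2 := by have := h.ht4; omega
      have hp : (d + κ) ^ t = (d + κ) ^ (t - 2) * (d + κ) ^ 2 := by
        rw [← pow_add, ← ht]
      rw [hp]
      have hq : (d + κ) ^ 2 ≤ 4 * d ^ 2 := by nlinarith
      gcongr
    refine (Finset.sum_le_sum h1).trans ?_
    rw [← Finset.mul_sum, ← Finset.mul_sum, ← Finset.mul_sum]
    gcongr
    linarith
  have hsmall := sm_sum h G y (univ.filter (fun z => ¬ M ^ 14 < |ms (y + G.mulVec z)|))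
    (fun z hz => not_lt.mp (Finset.mem_filter.mp hz).2)
  have hall : ∑ z : Fin g → ZMod 2, |Ek t (y + G.mulVec z)| ≤ n.choose t * (δ ^ 2 / 8) := by
    rw [← Finset.sum_filter_add_sum_filter_not univ
      (fun z => M ^ 14 < |ms (y + G.mulVec z)|)]
    have h1 : (δ + κ) ^ (t - 2) * 8 ≤ δ ^ 2 / 16 := by
      have ht : t - 2 = (t - 4) + 2 := by have := h.ht4; omega
      rw [ht, pow_add]
      have e1 : (δ + κ) ^ (t - 4) ≤ 1 / 512 := by
        refine le_trans ?_ h.h9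
        gcongr
        norm_num at hδ2 hκ1 ⊢
        linarith
      have e2 : (δ + κ) ^ 2 ≤ 4 * δ ^ 2 := by nlinarith
      have e3 : (δ + κ) ^ (t - 4) * (δ + κ) ^ 2 ≤ 1 / 512 * (4 * δ ^ 2) := by gcongr
      linarith
    have h2 : (2 / M) ^ t ≤ δ ^ 2 / 16 := by
      refine h.small.trans ?_
      have : (1 / M ^ 2) ^ 2 ≤ δ ^ 2 := by gcongr
      calc 1 / (16 * M ^ 4) = (1 / M ^ 2) ^ 2 / 16 := by field_simp
        _ ≤ _ := by gcongr
    have h3 : (n.choose t : ℝ) * ((δ + κ) ^ (t - 2) * 8) ≤ n.choose t * (δ ^ 2 / 16) := by gcongr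
    have h4 : (n.choose t : ℝ) * (2 / M) ^ t ≤ n.choose t * (δ ^ 2 / 16) := by gcongr
    linarith
  have := lam_of_sum h G hG y _ (by positivity) hall
  refine this.trans (le_of_eq ?_)
  ring

noncomputable def Wt (r n : ℕ) (M : ℝ) (v : Fin n → ZMod 2) : ℝ :=
  if M ^ 14 < |ms v| then
    (if |ms v| ≤ 0.999 * n then Real.exp (ms v ^ 2 / (4 * n)) else 2 ^ r) else 0

lemma Wt_nonneg (r n : ℕ) (M : ℝ) (v : Fin n → ZMod 2) : 0 ≤ Wt r n M v := by
  unfold Wt; split_ifs <;> positivity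

lemma pow_bound {r n : ℕ} (hrn : r ≤ n) (s q L X : ℝ) (hs : 0 ≤ s) (hq : 0 ≤ q)
    (hqL : q = s + L) (hL : L ≤ s * X) (hX : 0 ≤ X) : q ^ r ≤ s ^ r * Real.exp (n * X) := by
  have h1 : q ≤ s * Real.exp X := by
    have := Real.add_one_le_exp X
    nlinarith
  calc q ^ r ≤ (s * Real.exp X) ^ r := by gcongr
    _ = s ^ r * Real.exp (r * X) := by rw [mul_pow, ← Real.exp_nat_mul]
    _ ≤ _ := by gcongr

lemma pointwise {n t g r : ℕ} {M : ℝ} (h : Par n t g M) (hrn : r ≤ n)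
    (G : Matrix (Fin n) (Fin g) (ZMod 2)) (hG : GoodG n g M G) (y : Fin n → ZMod 2) :
    (2 * (((Srow t n g G).filter (fun p => p ⬝ᵥ y = 0)).card : ℝ)) ^ r
      ≤ ((Srow t n g G).card : ℝ) ^ r *
        (1 + 4 * n * (2 / M) ^ t + ∑ z : Fin g → ZMod 2, Wt r n M (y + G.mulVec z)) := by
  have hM0 : 0 < M := by linarith [h.hM]
  have hn0 : (0 : ℝ) < n := by rw [h.hn]; positivity
  have hq := two_q (t := t) G y
  set q : ℝ := 2 * (((Srow t n g G).filter (fun p => p ⬝ᵥ y = 0)).card : ℝ) with hqdef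
  have hq0 : 0 ≤ q := by positivity
  set s : ℝ := ((Srow t n g G).card : ℝ) with hs
  have hs0 : 0 ≤ s := Nat.cast_nonneg _
  have hWn : 0 ≤ ∑ z : Fin g → ZMod 2, Wt r n M (y + G.mulVec z) :=
    Finset.sum_nonneg fun z _ => Wt_nonneg _ _ _ _
  have he0 : 0 ≤ 4 * n * (2 / M) ^ t := by positivity
  obtain ⟨z0, -, hz0⟩ := Finset.exists_max_image (univ : Finset (Fin g → ZMod 2))
    (fun z => |ms (y + G.mulVec z)|) ⟨0, Finset.mem_univ _⟩
  have hmax : ∀ z, |ms (y + G.mulVec z)| ≤ |ms (y + G.mulVec z0)| :=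
    fun z => hz0 z (Finset.mem_univ z)
  have hWz : Wt r n M (y + G.mulVec z0) ≤ ∑ z : Fin g → ZMod 2, Wt r n M (y + G.mulVec z) :=
    Finset.single_le_sum (f := fun z => Wt r n M (y + G.mulVec z))
      (fun z _ => Wt_nonneg _ _ _ _) (Finset.mem_univ z0)
  by_cases h1 : M ^ 14 < |ms (y + G.mulVec z0)|
  · suffices hh : q ^ r ≤ s ^ r * Wt r n M (y + G.mulVec z0) by
      refine hh.trans ?_
      gcongr
      linarith
    by_cases h2 : |ms (y + G.mulVec z0)| ≤ 0.999 * n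
    · have hL := lam_mid h G hG y _ hmax h1.le h2
      rw [Wt, if_pos h1, if_pos h2]
      have := pow_bound hrn s q _ _ hs0 hq0 hq hL (by positivity)
      refine this.trans (le_of_eq ?_)
      rw [div_pow, sq_abs]
      congr 2
      field_simp
    · rw [Wt, if_pos h1, if_neg h2, ← mul_pow]
      refine pow_le_pow_left₀ hq0 ?_ r
      have : (((Srow t n g G).filter (fun p => p ⬝ᵥ y = 0)).card : ℝ) ≤ s := by
        rw [hs]; exact Nat.cast_le.mpr (Finset.card_filter_le _ _)
      linarith
  · have hL := lam_bulk h G hG y (fun z => (hmax z).trans (not_lt.mp h1))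
    have hb := pow_bound hrn s q _ _ hs0 hq0 hq hL (by positivity)
    refine hb.trans ?_
    have hsm : (n : ℝ) * (2 * (2 / M) ^ t) ≤ 1 := by
      have := h.hs
      rw [h.hn]; linarith
    have hx0 : 0 ≤ (n : ℝ) * (2 * (2 / M) ^ t) := by positivity
    have he := Real.abs_exp_sub_one_le (x := (n : ℝ) * (2 * (2 / M) ^ t))
      (by rw [abs_of_nonneg hx0]; exact hsm)
    rw [abs_of_nonneg hx0] at he
    have he2 := (le_abs_self _).trans he
    gcongr
    linarith

lemma ms_eq {n : ℕ} (v : Fin n → ZMod 2) : ms v = n - 2 * (hammingNorm v : ℝ) := by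
  have h : ∀ i, chi (v i) = 1 - 2 * (if v i ≠ 0 then (1 : ℝ) else 0) := by
    intro i
    by_cases h : v i = 0 <;> simp [chi, h]
    norm_num
  rw [ms, hammingNorm, Finset.card_filter]
  simp only [h]
  rw [Finset.sum_sub_distrib, ← Finset.mul_sum]
  simp

lemma cosh4 (n : ℕ) : (2 * Real.cosh 4) ^ n ≤ Real.exp (4.0004 * n) := by
  have h1 : Real.exp (-8) ≤ 0.0004 := by
    have h2 : (2.718 : ℝ) ^ 8 ≤ Real.exp 8 := by
      have : Real.exp 8 = Real.exp 1 ^ 8 := by rw [← Real.exp_nat_mul]; norm_num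
      rw [this]
      gcongr
      linarith [Real.exp_one_gt_d9]
    rw [Real.exp_neg, inv_le_comm₀ (Real.exp_pos _) (by norm_num)]
    refine le_trans ?_ h2
    norm_num
  have h2 : 2 * Real.cosh 4 ≤ Real.exp 4.0004 := by
    have e1 : 2 * Real.cosh 4 = Real.exp 4 * (1 + Real.exp (-8)) := by
      rw [Real.cosh_eq, mul_add, ← Real.exp_add]; norm_num
      ring
    have e2 : Real.exp 4.0004 = Real.exp 4 * Real.exp 0.0004 := by
      rw [← Real.exp_add]; norm_num
    rw [e1, e2]
    gcongr
    have := Real.add_one_le_exp 0.0004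
    linarith
  calc _ ≤ (Real.exp 4.0004) ^ n := by
        gcongr
    _ = _ := by rw [← Real.exp_nat_mul, mul_comm]

lemma Wt_fiber {n r : ℕ} {M : ℝ} (hn : (n : ℝ) = M ^ 16) (hM : 4 ≤ M)
    (hr : (r : ℝ) ≤ 0.99 * n) (k : ℕ) :
    ∑ v ∈ univ.filter (fun v : Fin n → ZMod 2 => hammingNorm v = k), Wt r n M v
      ≤ 2 ^ n * Real.exp (-(M ^ 12 / 4)) := by
  have hM0 : 0 < M := by linarith
  have hn0 : (0 : ℝ) < n := by rw [hn]; positivity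
  set T := univ.filter (fun v : Fin n → ZMod 2 => hammingNorm v = k) with hT
  set c : ℝ := n - 2 * (k : ℝ) with hc
  have hms : ∀ v ∈ T, ms v = c := by
    intro v hv
    rw [ms_eq, (Finset.mem_filter.mp hv).2]
  have hW : ∀ v ∈ T, Wt r n M v = if M ^ 14 < |c| then
      (if |c| ≤ 0.999 * n then Real.exp (c ^ 2 / (4 * n)) else 2 ^ r) else 0 := by
    intro v hv
    rw [Wt, hms v hv]
  rw [Finset.sum_congr rfl hW, Finset.sum_const, nsmul_eq_mul]
  split_ifs with h1 h2
  · have hcard := card_ms_gauss (c / n) (c / n * c) T (fun v hv => by rw [hms v hv])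
    calc _ ≤ 2 ^ n * Real.exp (n * ((c / n) ^ 2 / 2) - c / n * c) * Real.exp (c ^ 2 / (4 * n)) := by
          gcongr
      _ = 2 ^ n * Real.exp (-(c ^ 2 / (4 * n))) := by
        rw [mul_assoc, ← Real.exp_add]
        congr 2
        field_simp
        ring
      _ ≤ _ := by
        refine mul_le_mul_of_nonneg_left (Real.exp_le_exp.mpr (neg_le_neg ?_)) (by positivity)
        rw [le_div_iff₀ (by positivity), hn]
        have : (M ^ 14) ^ 2 ≤ c ^ 2 := by rw [← sq_abs c]; gcongr
        calc _ = (M ^ 14) ^ 2 := by ring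
          _ ≤ _ := this
  · have hcard : (T.card : ℝ) ≤ (2 * Real.cosh 4) ^ n * Real.exp (-(4 * |c|)) := by
      rcases abs_cases c with ⟨h3, -⟩ | ⟨h3, -⟩
      · exact card_ms_ge 4 _ T (fun v hv => by rw [hms v hv, h3])
      · have := card_ms_ge (-4) (4 * |c|) T (fun v hv => by rw [hms v hv, h3]; linarith)
        rwa [Real.cosh_neg] at this
    have h2r : (2 : ℝ) ^ r ≤ Real.exp (Real.log 2 * (0.99 * n)) := by
      have : (2 : ℝ) ^ r = Real.exp (Real.log 2 * r) := by
        rw [mul_comm, Real.exp_nat_mul, Real.exp_log (by norm_num)]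
      rw [this]
      have := Real.log_pos (by norm_num : (1 : ℝ) < 2)
      gcongr
    have h2n : (2 : ℝ) ^ n = Real.exp (Real.log 2 * n) := by
      rw [mul_comm, Real.exp_nat_mul, Real.exp_log (by norm_num)]
    rw [h2n]
    calc _ ≤ Real.exp (4.0004 * n) * Real.exp (-(4 * |c|)) * Real.exp (Real.log 2 * (0.99 * n)) := by
          gcongr
          refine hcard.trans ?_
          gcongr
          exact cosh4 n
      _ ≤ _ := by
        rw [← Real.exp_add, ← Real.exp_add, ← Real.exp_add]
        apply Real.exp_le_exp.mpr
        have h4 : M ^ 12 / 4 ≤ 0.002 * n := by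
          rw [hn]
          have h5 : (4 : ℝ) ^ 4 ≤ M ^ 4 := by gcongr
          have h6 : M ^ 12 * 4 ^ 4 ≤ M ^ 12 * M ^ 4 := by gcongr
          have h7 : M ^ 12 * M ^ 4 = M ^ 16 := by ring
          have h8 : 0 ≤ M ^ 12 := by positivity
          rw [h7] at h6
          norm_num at h6 ⊢
          linarith
        have h5 := not_le.mp h2
        have h6 : 0.69 * (n : ℝ) ≤ Real.log 2 * n := by
          gcongr
          linarith [Real.log_two_gt_d9]
        norm_num at h4 h5 h6 ⊢
        linarith
  · rw [mul_zero]; positivity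

lemma Wt_sum {n r : ℕ} {M : ℝ} (hn : (n : ℝ) = M ^ 16) (hM : 4 ≤ M)
    (hr : (r : ℝ) ≤ 0.99 * n) :
    ∑ v : Fin n → ZMod 2, Wt r n M v
      ≤ (n + 1) * (2 ^ n * Real.exp (-(M ^ 12 / 4))) := by
  rw [← Finset.sum_fiberwise_of_maps_to (s := univ) (t := Finset.range (n + 1))
    (g := fun v : Fin n → ZMod 2 => hammingNorm v)
    (fun v _ => by
      rw [Finset.mem_range, Nat.lt_succ_iff]
      simpa using hammingNorm_le_card_fintype (x := v))]
  refine (Finset.sum_le_sum fun k _ => Wt_fiber hn hM hr k).trans ?_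
  rw [Finset.sum_const, Finset.card_range, nsmul_eq_mul]
  push_cast
  exact le_rfl

lemma bad_bound {n t g r : ℕ} {M : ℝ} (h : Par n t g M) (hr : (r : ℝ) ≤ 0.99 * n)
    (G : Matrix (Fin n) (Fin g) (ZMod 2)) (hG : GoodG n g M G) :
    (((PsetOf t r n g G).filter (fun P => ¬ P.rank = r)).card : ℝ)
      ≤ ((PsetOf t r n g G).card : ℝ) *
        (4 * n * (2 / M) ^ t + 2 ^ g * ((n + 1) * Real.exp (-(M ^ 12 / 4)))) := by
  have hrn : r ≤ n := by
    have : (r : ℝ) ≤ n := by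
      have : (0 : ℝ) ≤ n := Nat.cast_nonneg _
      norm_num at hr
      linarith
    exact_mod_cast this
  have h1 := bad_count (t := t) (r := r) G
  have h2 := Finset.sum_le_sum (s := univ) fun y _ => pointwise h hrn G hG y
  have h3 : ∑ y : Fin n → ZMod 2, ∑ z : Fin g → ZMod 2, Wt r n M (y + G.mulVec z)
      = 2 ^ g * ∑ v : Fin n → ZMod 2, Wt r n M v := by
    rw [Finset.sum_comm]
    have : ∀ z : Fin g → ZMod 2, ∑ y : Fin n → ZMod 2, Wt r n M (y + G.mulVec z)
        = ∑ v : Fin n → ZMod 2, Wt r n M v := fun z =>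
      Equiv.sum_comp (Equiv.addRight (G.mulVec z)) (Wt r n M)
    simp only [this]
    simp
  have h4 := Wt_sum (M := M) h.hn h.hM hr
  rw [← Finset.mul_sum, Finset.sum_add_distrib, h3, Finset.sum_const, nsmul_eq_mul] at h2
  have h5 : (((univ : Finset (Fin n → ZMod 2)).card : ℕ) : ℝ) = 2 ^ n := by simp
  rw [h5] at h2
  rw [Pset_card]
  push_cast
  set s : ℝ := ((Srow t n g G).card : ℝ) ^ r
  have hs : 0 ≤ s := by positivity
  have h6 : (0 : ℝ) < 2 ^ n := by positivity
  refine le_of_mul_le_mul_left ?_ h6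
  have h7 : s * (2 ^ g * ∑ v : Fin n → ZMod 2, Wt r n M v)
      ≤ s * (2 ^ g * ((n + 1) * (2 ^ n * Real.exp (-(M ^ 12 / 4))))) := by gcongr
  linarith

lemma count_mulVec {n g : ℕ} (z : Fin g → ZMod 2) (hz : z ≠ 0) (p : (Fin n → ZMod 2) → Prop) :
    (2 : ℝ) ^ n * ((univ.filter
        (fun G : Matrix (Fin n) (Fin g) (ZMod 2) => p (G.mulVec z))).card : ℝ)
      = (Fintype.card (Matrix (Fin n) (Fin g) (ZMod 2)) : ℝ)
        * ((univ.filter (fun v : Fin n → ZMod 2 => p v)).card : ℝ) := by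
  obtain ⟨j, hj⟩ := Function.ne_iff.mp hz
  have hj1 : z j = 1 := (zmod2_cases (z j)).resolve_left hj
  set f : (Fin n → ZMod 2) → ℝ := fun v => if p v then 1 else 0 with hf
  have e1 : ((univ.filter
        (fun G : Matrix (Fin n) (Fin g) (ZMod 2) => p (G.mulVec z))).card : ℝ)
      = ∑ G : Matrix (Fin n) (Fin g) (ZMod 2), f (G.mulVec z) := by
    rw [Finset.card_filter]; push_cast; rfl
  have e2 : ((univ.filter (fun v : Fin n → ZMod 2 => p v)).card : ℝ) = ∑ v, f v := by
    rw [Finset.card_filter]; push_cast; rfl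
  have e3 : ∀ v : Fin n → ZMod 2, ∑ G : Matrix (Fin n) (Fin g) (ZMod 2), f (G.mulVec z)
      = ∑ G : Matrix (Fin n) (Fin g) (ZMod 2), f (G.mulVec z + v) := by
    intro v
    rw [← Equiv.sum_comp (Equiv.addRight (Matrix.vecMulVec v (Pi.single j 1)))
      (fun G : Matrix (Fin n) (Fin g) (ZMod 2) => f (G.mulVec z))]
    refine Finset.sum_congr rfl fun G _ => ?_
    congr 1
    rw [Equiv.coe_addRight, Matrix.add_mulVec]
    congr 1
    ext i
    simp [Matrix.mulVec, dotProduct, Matrix.vecMulVec, Pi.single_apply, hj1]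
  have e4 : ∑ v : Fin n → ZMod 2, ∑ G : Matrix (Fin n) (Fin g) (ZMod 2), f (G.mulVec z)
      = ∑ G : Matrix (Fin n) (Fin g) (ZMod 2), ∑ v : Fin n → ZMod 2, f v := by
    rw [Finset.sum_congr rfl fun v _ => e3 v, Finset.sum_comm]
    refine Finset.sum_congr rfl fun G _ => ?_
    exact Equiv.sum_comp (Equiv.addLeft (G.mulVec z)) f
  rw [e1, e2]
  rw [Finset.sum_const, Finset.sum_const] at e4
  simp only [nsmul_eq_mul, Finset.card_univ] at e4
  rw [← e4]
  simp

lemma badG_count {n t g : ℕ} {M : ℝ} (h : Par n t g M) :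
    ((univ.filter (fun G : Matrix (Fin n) (Fin g) (ZMod 2) => ¬ GoodG n g M G)).card : ℝ)
      ≤ (Fintype.card (Matrix (Fin n) (Fin g) (ZMod 2)) : ℝ)
        * (2 ^ g * (2 * Real.exp (-(M ^ 4 / 2)))) := by
  have hM0 : 0 < M := by linarith [h.hM]
  set K : ℝ := (Fintype.card (Matrix (Fin n) (Fin g) (ZMod 2)) : ℝ) with hK
  have hK0 : 0 ≤ K := Nat.cast_nonneg _
  have h1 : (univ.filter (fun G : Matrix (Fin n) (Fin g) (ZMod 2) => ¬ GoodG n g M G)) ⊆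
      (univ.filter (fun z : Fin g → ZMod 2 => z ≠ 0)).biUnion (fun z =>
        univ.filter (fun G : Matrix (Fin n) (Fin g) (ZMod 2) => M ^ 10 ≤ |ms (G.mulVec z)|)) := by
    intro G hG
    have hG' := (Finset.mem_filter.mp hG).2
    unfold GoodG at hG'
    push Not at hG'
    obtain ⟨z, hz, hz2⟩ := hG'
    rw [Finset.mem_biUnion]
    exact ⟨z, by simp [hz], by simp [hz2.le]⟩
  have h2 : ∀ z ∈ univ.filter (fun z : Fin g → ZMod 2 => z ≠ 0),
      ((univ.filter (fun G : Matrix (Fin n) (Fin g) (ZMod 2) =>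
        M ^ 10 ≤ |ms (G.mulVec z)|)).card : ℝ) ≤ K * (2 * Real.exp (-(M ^ 4 / 2))) := by
    intro z hz
    have e1 := count_mulVec (n := n) z (Finset.mem_filter.mp hz).2 (fun v => M ^ 10 ≤ |ms v|)
    have e2 := card_ms_tail (n := n) (1 / M ^ 6) (M ^ 10) (by positivity)
    have e3 : (n : ℝ) * ((1 / M ^ 6) ^ 2 / 2) - 1 / M ^ 6 * M ^ 10 = -(M ^ 4 / 2) := by
      rw [h.hn]; field_simp; ring
    rw [e3] at e2
    refine le_of_mul_le_mul_left ?_ (by positivity : (0 : ℝ) < 2 ^ n)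
    rw [e1]
    have := mul_le_mul_of_nonneg_left e2 hK0
    linarith
  have h3 : ((univ.filter (fun G : Matrix (Fin n) (Fin g) (ZMod 2) => ¬ GoodG n g M G)).card : ℝ)
      ≤ ∑ z ∈ univ.filter (fun z : Fin g → ZMod 2 => z ≠ 0),
        ((univ.filter (fun G : Matrix (Fin n) (Fin g) (ZMod 2) =>
          M ^ 10 ≤ |ms (G.mulVec z)|)).card : ℝ) := by
    exact_mod_cast (Finset.card_le_card h1).trans Finset.card_biUnion_le
  refine h3.trans ((Finset.sum_le_sum h2).trans ?_)
  rw [Finset.sum_const, nsmul_eq_mul]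
  have h4 : ((univ.filter (fun z : Fin g → ZMod 2 => z ≠ 0)).card : ℝ) ≤ 2 ^ g := by
    have := Finset.card_le_univ (univ.filter (fun z : Fin g → ZMod 2 => z ≠ 0))
    rw [Fintype.card_fun, ZMod.card, Fintype.card_fin] at this
    exact_mod_cast this
  have := mul_le_mul_of_nonneg_right h4
    (by positivity : 0 ≤ K * (2 * Real.exp (-(M ^ 4 / 2))))
  linarith

lemma event_of_good {n t g r : ℕ} {M : ℝ} (h : Par n t g M) (hr : (r : ℝ) ≤ 0.99 * n)
    (G : Matrix (Fin n) (Fin g) (ZMod 2)) (hG : GoodG n g M G) :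
    (PsetOf t r n g G).Nonempty ∧
      1 - (4 * n * (2 / M) ^ t + M ^ t * ((n + 1) * Real.exp (-(M ^ 12 / 4)))) ≤
        (((PsetOf t r n g G).filter (fun P => P.rank = r)).card : ℝ) /
          ((PsetOf t r n g G).card : ℝ) := by
  have hpos : (0 : ℝ) < (PsetOf t r n g G).card := by
    rw [Pset_card]; push_cast
    exact pow_pos (S_pos h G hG) r
  refine ⟨Finset.card_pos.mp (by exact_mod_cast hpos), ?_⟩
  rw [le_div_iff₀ hpos]
  have h1 := bad_bound h hr G hG
  have h2 := Finset.card_filter_add_card_filter_not (s := PsetOf t r n g G) (fun P => P.rank = r)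
  have h3 : (((PsetOf t r n g G).filter (fun P => P.rank = r)).card : ℝ)
      + (((PsetOf t r n g G).filter (fun P => ¬ P.rank = r)).card : ℝ)
      = ((PsetOf t r n g G).card : ℝ) := by exact_mod_cast h2
  have h4 : (2 : ℝ) ^ g * ((n + 1) * Real.exp (-(M ^ 12 / 4)))
      ≤ M ^ t * ((n + 1) * Real.exp (-(M ^ 12 / 4))) := by
    gcongr
    exact h.h2g
  have h5 := mul_le_mul_of_nonneg_left h4 hpos.le
  nlinarith

lemma prob_event {n t g r : ℕ} {M : ℝ} (h : Par n t g M) (hr : (r : ℝ) ≤ 0.99 * n) :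
    1 - M ^ t * (2 * Real.exp (-(M ^ 4 / 2))) ≤
          ((univ.filter (fun G : Matrix (Fin n) (Fin g) (ZMod 2) =>
              (PsetOf t r n g G).Nonempty ∧
              1 - (4 * n * (2 / M) ^ t + M ^ t * ((n + 1) * Real.exp (-(M ^ 12 / 4)))) ≤
                (((PsetOf t r n g G).filter (fun P => P.rank = r)).card : ℝ) /
                  ((PsetOf t r n g G).card : ℝ))).card : ℝ) /
            (Fintype.card (Matrix (Fin n) (Fin g) (ZMod 2)) : ℝ) := by
  have hK0 : (0 : ℝ) < (Fintype.card (Matrix (Fin n) (Fin g) (ZMod 2)) : ℝ) := by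
    exact_mod_cast Fintype.card_pos
  rw [le_div_iff₀ hK0]
  have h1 := badG_count h
  have h2 := Finset.card_filter_add_card_filter_not
    (s := (univ : Finset (Matrix (Fin n) (Fin g) (ZMod 2)))) (fun G => GoodG n g M G)
  rw [Finset.card_univ] at h2
  have h3 : ((univ.filter (fun G : Matrix (Fin n) (Fin g) (ZMod 2) => GoodG n g M G)).card : ℝ)
      + ((univ.filter (fun G : Matrix (Fin n) (Fin g) (ZMod 2) => ¬ GoodG n g M G)).card : ℝ)
      = (Fintype.card (Matrix (Fin n) (Fin g) (ZMod 2)) : ℝ) := by exact_mod_cast h2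
  have h4 : (2 : ℝ) ^ g * (2 * Real.exp (-(M ^ 4 / 2))) ≤ M ^ t * (2 * Real.exp (-(M ^ 4 / 2))) := by
    gcongr
    exact h.h2g
  have h5 := mul_le_mul_of_nonneg_left h4 hK0.le
  have h6 : ((univ.filter (fun G : Matrix (Fin n) (Fin g) (ZMod 2) => GoodG n g M G)).card : ℝ)
      ≤ ((univ.filter (fun G : Matrix (Fin n) (Fin g) (ZMod 2) =>
              (PsetOf t r n g G).Nonempty ∧
              1 - (4 * n * (2 / M) ^ t + M ^ t * ((n + 1) * Real.exp (-(M ^ 12 / 4)))) ≤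
                (((PsetOf t r n g G).filter (fun P => P.rank = r)).card : ℝ) /
                  ((PsetOf t r n g G).card : ℝ))).card : ℝ) := by
    refine Nat.cast_le.mpr (Finset.card_le_card fun G hG => ?_)
    rw [Finset.mem_filter] at hG ⊢
    exact ⟨hG.1, event_of_good h hr G hG.2⟩
  linarith

lemma two_div_pow (M : ℝ) (hM : 4 ≤ M) (t j : ℕ) (h : 2 * j ≤ t) : (2 / M) ^ t ≤ 1 / M ^ j := by
  have hM0 : 0 < M := by linarith
  have h1 : (2 / M) ^ t ≤ (2 / M) ^ (2 * j) := by
    apply pow_le_pow_of_le_one (by positivity) _ h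
    rw [div_le_one hM0]; linarith
  refine h1.trans ?_
  rw [pow_mul, ← one_div_pow]
  gcongr
  rw [div_pow, div_le_div_iff₀ (by positivity) hM0]
  nlinarith

noncomputable def Mn (n : ℕ) : ℝ := (n : ℝ) ^ ((1 : ℝ) / 16)

lemma Mn_pow (n : ℕ) : (n : ℝ) = Mn n ^ 16 := by
  rw [Mn, ← Real.rpow_natCast, ← Real.rpow_mul (Nat.cast_nonneg _)]
  norm_num

lemma Mn_tendsto : Tendsto Mn atTop atTop :=
  (tendsto_rpow_atTop (by norm_num : (0 : ℝ) < 1 / 16)).comp tendsto_natCast_atTop_atTop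

lemma Mn_exp (j : ℕ) : ∀ᶠ n : ℕ in atTop, Real.exp (-(Mn n)) ≤ 1 / Mn n ^ j := by
  have h1 := (Real.tendsto_pow_mul_exp_neg_atTop_nhds_zero j).comp Mn_tendsto
  have h2 := h1.eventually (gt_mem_nhds (zero_lt_one))
  filter_upwards [h2, Mn_tendsto.eventually_ge_atTop 4] with n hn hM
  have : 0 < Mn n ^ j := by positivity
  rw [le_div_iff₀ this, mul_comm]
  exact hn.le

lemma t_tendsto (t : ℕ → ℕ)
    (ht1 : Tendsto (fun n : ℕ => (t n : ℝ) / Real.sqrt (Real.logb 2 n)) atTop atTop) (A : ℕ) :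
    ∀ᶠ n in atTop, A ≤ t n := by
  filter_upwards [ht1.eventually_ge_atTop (A : ℝ), eventually_ge_atTop 2] with n hn h2
  have h3 : (1 : ℝ) ≤ Real.logb 2 n := by
    rw [Real.le_logb_iff_rpow_le (by norm_num) (by positivity)]
    simpa using h2
  have h4 : 1 ≤ Real.sqrt (Real.logb 2 n) := Real.one_le_sqrt.mpr h3
  rw [le_div_iff₀ (by linarith)] at hn
  have hA : (0 : ℝ) ≤ A := Nat.cast_nonneg _
  have : (A : ℝ) ≤ t n := by nlinarith
  exact_mod_cast this

lemma t_le_Mn (C : ℝ) (t : ℕ → ℕ) (ht2 : ∀ n : ℕ, (t n : ℝ) ≤ C * Real.logb 2 n) (hC : 0 < C) :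
    ∀ᶠ n in atTop, 5 * (t n : ℝ) ≤ Mn n := by
  have h1 := (isLittleO_log_rpow_atTop (by norm_num : (0 : ℝ) < 1 / 16)).comp_tendsto
    tendsto_natCast_atTop_atTop
  have hl2 := Real.log_pos (by norm_num : (1 : ℝ) < 2)
  have h2 := h1.bound (c := Real.log 2 / (5 * C)) (by positivity)
  filter_upwards [h2] with n hn
  have hn' : Real.log n ≤ Real.log 2 / (5 * C) * Mn n := by
    have h3 : 0 ≤ Mn n := by unfold Mn; positivity
    have := (le_abs_self _).trans hn
    simp only [Function.comp, Real.norm_eq_abs] at this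
    rwa [show (n : ℝ) ^ ((1 : ℝ) / 16) = Mn n from rfl, abs_of_nonneg h3] at this
  have h4 := ht2 n
  have h5 : 5 * (C * Real.logb 2 n) ≤ Mn n := by
    rw [Real.logb]
    calc _ = (5 * C / Real.log 2) * Real.log n := by ring
      _ ≤ (5 * C / Real.log 2) * (Real.log 2 / (5 * C) * Mn n) := by gcongr
      _ = _ := by field_simp
  linarith

lemma pow_t_le (M : ℝ) (hM : 4 ≤ M) (t : ℕ) (ht : 5 * (t : ℝ) ≤ M) :
    M ^ t ≤ Real.exp (M ^ 2) := by
  have hM0 : 0 < M := by linarith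
  calc M ^ t = Real.exp (t * Real.log M) := by rw [Real.exp_nat_mul, Real.exp_log hM0]
    _ ≤ _ := by
      apply Real.exp_le_exp.mpr
      have h1 : Real.log M ≤ M := (Real.log_le_sub_one_of_pos hM0).trans (by linarith)
      have h0 : 0 ≤ Real.log M := Real.log_nonneg (by linarith)
      have ht0 : (0 : ℝ) ≤ t := Nat.cast_nonneg _
      have : (t : ℝ) * Real.log M ≤ M * M := by gcongr; linarith
      linarith [sq M]

lemma par_eventually (C : ℝ) (hC : 0 < C) (t : ℕ → ℕ)
    (ht1 : Tendsto (fun n : ℕ => (t n : ℝ) / Real.sqrt (Real.logb 2 n)) atTop atTop)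
    (ht2 : ∀ n : ℕ, (t n : ℝ) ≤ C * Real.logb 2 n) :
    ∀ᶠ n in atTop, ∀ g : ℕ, (g : ℝ) ≤ 1 / (16 * C) * (t n : ℝ) ^ 2 → Par n (t n) g (Mn n) := by
  obtain ⟨A, hA⟩ := exists_pow_lt_of_lt_one (by norm_num : (0 : ℝ) < 1 / 512)
    (by norm_num : (0.9995 : ℝ) < 1)
  filter_upwards [t_tendsto t ht1 40, t_tendsto t ht1 (A + 4), t_le_Mn C t ht2 hC,
    Mn_tendsto.eventually_ge_atTop 4, eventually_ge_atTop 1] with n h40 hA4 h5 hM hn1 g hg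
  have hM0 : 0 < Mn n := by linarith
  refine ⟨Mn_pow n, hM, ?_, ?_, ?_, by omega, ?_⟩
  · have hl2 := Real.log_pos (by norm_num : (1 : ℝ) < 2)
    have hn0 : (0 : ℝ) < n := by exact_mod_cast hn1
    have e1 : (2 : ℝ) ^ g = Real.exp (g * Real.log 2) := by
      rw [Real.exp_nat_mul, Real.exp_log (by norm_num)]
    have e2 : Mn n ^ (t n) = Real.exp (t n * Real.log (Mn n)) := by
      rw [Real.exp_nat_mul, Real.exp_log hM0]
    have e3 : Real.log (Mn n) = 1 / 16 * Real.log n := by rw [Mn, Real.log_rpow hn0]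
    rw [e1, e2, e3]
    apply Real.exp_le_exp.mpr
    have ht0 : (0 : ℝ) ≤ t n := Nat.cast_nonneg _
    have e4 := ht2 n
    calc (g : ℝ) * Real.log 2 ≤ (1 / (16 * C) * (t n : ℝ) ^ 2) * Real.log 2 := by gcongr
      _ = (1 / (16 * C) * (t n : ℝ) * t n) * Real.log 2 := by ring
      _ ≤ (1 / (16 * C) * (t n : ℝ) * (C * Real.logb 2 n)) * Real.log 2 := by gcongr
      _ = _ := by rw [Real.logb]; field_simp
  · have : Mn n ≤ Mn n ^ 4 := le_self_pow₀ (by linarith) (by norm_num)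
    linarith
  · have h1 := two_div_pow (Mn n) hM (t n) 20 (by omega)
    calc _ ≤ 1 / Mn n ^ 20 * Mn n ^ 16 := by gcongr
      _ = 1 / Mn n ^ 4 := by field_simp
      _ ≤ 1 / 16 := by
        apply one_div_le_one_div_of_le (by norm_num)
        calc (16 : ℝ) ≤ 4 ^ 4 := by norm_num
          _ ≤ _ := by gcongr
  · refine le_trans ?_ hA.le
    exact pow_le_pow_of_le_one (by norm_num) (by norm_num) (by omega)

lemma nu2_bound (M : ℝ) (hM : 4 ≤ M) (t : ℕ) (ht : 5 * (t : ℝ) ≤ M) :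
    M ^ t * Real.exp (-(M ^ 4 / 2)) ≤ Real.exp (-M) := by
  calc _ ≤ Real.exp (M ^ 2) * Real.exp (-(M ^ 4 / 2)) := by gcongr; exact pow_t_le M hM t ht
    _ = Real.exp (M ^ 2 + -(M ^ 4 / 2)) := by rw [Real.exp_add]
    _ ≤ _ := by
      apply Real.exp_le_exp.mpr
      have h1 : 16 ≤ M ^ 2 := by nlinarith
      have h2 : M ^ 4 = M ^ 2 * M ^ 2 := by ring
      nlinarith

lemma nu1_bound (M : ℝ) (hM : 4 ≤ M) (t : ℕ) (ht : 5 * (t : ℝ) ≤ M) :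
    M ^ t * Real.exp (-(M ^ 12 / 4)) ≤ Real.exp (-M) := by
  refine le_trans ?_ (nu2_bound M hM t ht)
  have h1 : M ^ 4 / 2 ≤ M ^ 12 / 4 := by
    have h2 : (4 : ℝ) ^ 8 ≤ M ^ 8 := by gcongr
    have h3 : M ^ 12 = M ^ 4 * M ^ 8 := by ring
    have h4 : 0 < M ^ 4 := by positivity
    rw [h3]; nlinarith
  gcongr

/-- Fix `C > 0` and `r, t : ℕ → ℕ` with `r n ≤ 0.99·n`,
`t n/√(log n) → ∞`, `t n ≤ C·log n`.  Then there exist `β > 0` and negligible `ν₁, ν₂` such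
that for all `n` and all `1 ≤ g ≤ β·(t n)²`: with probability at least `1 − ν₂ n` over a
uniform `G* ∈ F₂^{n×g}`, the set `𝒫(G*)` is nonempty and a uniformly random `P* ← 𝒫(G*)`
has full row rank `r n` with probability at least `1 − ν₁ n`. -/
theorem stmt_6 (C : ℝ) (hC : 0 < C) (r t : ℕ → ℕ)
    (hr : ∀ n : ℕ, (r n : ℝ) ≤ 0.99 * n)
    (ht1 : Tendsto (fun n : ℕ => (t n : ℝ) / Real.sqrt (Real.logb 2 n)) atTop atTop)
    (ht2 : ∀ n : ℕ, (t n : ℝ) ≤ C * Real.logb 2 n) :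
    ∃ β : ℝ, 0 < β ∧ ∃ ν₁ ν₂ : ℕ → ℝ, Negligible ν₁ ∧ Negligible ν₂ ∧
      ∀ n g : ℕ, 1 ≤ g → (g : ℝ) ≤ β * (t n : ℝ) ^ 2 →
        1 - ν₂ n ≤
          ((univ.filter (fun G : Matrix (Fin n) (Fin g) (ZMod 2) =>
              (PsetOf (t n) (r n) n g G).Nonempty ∧
              1 - ν₁ n ≤
                (((PsetOf (t n) (r n) n g G).filter (fun P => P.rank = r n)).card : ℝ) /
                  ((PsetOf (t n) (r n) n g G).card : ℝ))).card : ℝ) /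
            (Fintype.card (Matrix (Fin n) (Fin g) (ZMod 2)) : ℝ) := by
  have hev := par_eventually C hC t ht1 ht2
  obtain ⟨N0, hN0⟩ := eventually_atTop.mp hev
  refine ⟨1 / (16 * C), by positivity,
    fun n => if n < N0 then 1 else
      4 * n * (2 / Mn n) ^ (t n) + Mn n ^ (t n) * ((n + 1) * Real.exp (-(Mn n ^ 12 / 4))),
    fun n => if n < N0 then 1 else Mn n ^ (t n) * (2 * Real.exp (-(Mn n ^ 4 / 2))), ?_, ?_, ?_⟩
  · intro k
    apply eventually_atTop.mp
    filter_upwards [eventually_ge_atTop N0, t_tendsto t ht1 (2 * (16 * k + 18)),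
      t_le_Mn C t ht2 hC, Mn_tendsto.eventually_ge_atTop 4, Mn_exp (16 * k + 18)]
      with n hn ht h5 hM he
    rw [if_neg (not_lt.mpr hn)]
    have hM0 : 0 < Mn n := by linarith
    have h1 := two_div_pow (Mn n) hM (t n) (16 * k + 18) ht
    have h2 := nu1_bound (Mn n) hM (t n) h5
    have hnM := Mn_pow n
    have hM16 : 1 ≤ Mn n ^ 16 := one_le_pow₀ (by linarith)
    have hk : (n : ℝ) ^ k = Mn n ^ (16 * k) := by rw [pow_mul, ← hnM]
    have hx : Mn n ^ 16 * (1 / Mn n ^ (16 * k + 18)) = 1 / Mn n ^ (16 * k) * (1 / Mn n ^ 2) := by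
      rw [pow_add]; field_simp
    have hy : 1 / Mn n ^ 2 ≤ 1 / 16 := by
      apply one_div_le_one_div_of_le (by norm_num); nlinarith
    rw [hk]
    have hp : 0 < 1 / Mn n ^ (16 * k) := by positivity
    have hz : 1 / Mn n ^ (16 * k) * (1 / Mn n ^ 2) ≤ 1 / Mn n ^ (16 * k) * (1 / 16) := by gcongr
    have a1 : 4 * (n : ℝ) * (2 / Mn n) ^ (t n) ≤ 4 * (1 / Mn n ^ (16 * k) * (1 / Mn n ^ 2)) := by
      rw [← hx, ← hnM]
      calc _ ≤ 4 * (n : ℝ) * (1 / Mn n ^ (16 * k + 18)) := by gcongr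
        _ = _ := by ring
    have a2 : Mn n ^ (t n) * (((n : ℝ) + 1) * Real.exp (-(Mn n ^ 12 / 4)))
        ≤ 2 * (1 / Mn n ^ (16 * k) * (1 / Mn n ^ 2)) := by
      rw [← hx]
      have hn2 : (n : ℝ) + 1 ≤ 2 * Mn n ^ 16 := by linarith
      calc _ = ((n : ℝ) + 1) * (Mn n ^ (t n) * Real.exp (-(Mn n ^ 12 / 4))) := by ring
        _ ≤ (2 * Mn n ^ 16) * (1 / Mn n ^ (16 * k + 18)) := by
          gcongr
          exact h2.trans he
        _ = _ := by ring
    linarith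
  · intro k
    apply eventually_atTop.mp
    filter_upwards [eventually_ge_atTop N0,
      t_le_Mn C t ht2 hC, Mn_tendsto.eventually_ge_atTop 4, Mn_exp (16 * k + 1)]
      with n hn h5 hM he
    rw [if_neg (not_lt.mpr hn)]
    have hM0 : 0 < Mn n := by linarith
    have h2 := nu2_bound (Mn n) hM (t n) h5
    have hk : (n : ℝ) ^ k = Mn n ^ (16 * k) := by rw [pow_mul, ← Mn_pow n]
    rw [hk]
    calc _ = 2 * (Mn n ^ (t n) * Real.exp (-(Mn n ^ 4 / 2))) := by ring
      _ ≤ Mn n * (1 / Mn n ^ (16 * k + 1)) := by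
        gcongr
        · linarith
        · exact h2.trans he
      _ = _ := by rw [pow_succ]; field_simp
  · intro n g _ hg
    by_cases hn : n < N0
    · simp only [if_pos hn, sub_self]
      positivity
    · simp only [if_neg hn]
      exact prob_event (hN0 n (not_lt.mp hn) g hg) (hr n)
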